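/- Let P be a Markov kernel on a measurable space (E, ℰ), let V : E → [0, ∞] be measurable, let 0 ≤ β < 1 and b' ≥ 0, and suppose that for every x ∈ E, ∫ V(y) P(x, dy) ≤ βV(x) + b'. Let N be a probability distribution on the positive integers (representing a random sampling time independent of the chain). Then for every x ∈ E, the expectation of V of the chain started at x and sampled at the independent random time N satisfies Σ_{n≥1} N({n}) ∫ V(y) Pⁿ(x, dy) ≤ (Σ_{n≥1} N({n}) βⁿ) V(x) + b'/(1 − β). In particular the subsampled chain satisfies a geometric drift condition with drift coefficient E[β^N] < 1 and constant b'/(1−β), neither depending on anything about N beyond its distribution. -/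

import Mathlib

open MeasureTheory ProbabilityTheory
open scoped ENNReal NNReal

/-- The `n`-step transition kernel: the `n`-fold composition of `P` with itself. -/
noncomputable def iterKernel {E : Type*} [MeasurableSpace E] (P : Kernel E E) : ℕ → Kernel E E
  | 0 => Kernel.id
  | n + 1 => P ∘ₖ iterKernel P n

lemma iterKernel_univ {E : Type*} [MeasurableSpace E] (P : Kernel E E) [IsMarkovKernel P] (n : ℕ) :
    IsMarkovKernel (iterKernel P n) := by
  induction n with
  | zero => unfold iterKernel; infer_instance
  | succ n ih => unfold iterKernel; infer_instance

lemma iterKernel_drift {E : Type*} [MeasurableSpace E] (P : Kernel E E) [IsMarkovKernel P]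
    (V : E → ℝ≥0∞) (hV : Measurable V) (β b' : ℝ≥0∞)
    (hβ : β < 1)
    (hdrift : ∀ x : E, ∫⁻ y, V y ∂(P x) ≤ β * V x + b') (n : ℕ) (x : E) :
    ∫⁻ y, V y ∂(iterKernel P n x) ≤ β ^ n * V x + b' / (1 - β) := by
  induction n with
  | zero =>
    simp only [iterKernel, Kernel.id_apply, lintegral_dirac' x hV, pow_zero, one_mul]
    exact le_self_add
  | succ n ih =>
    have := iterKernel_univ P n
    have h0 : (1 - β) ≠ 0 := (tsub_pos_of_lt hβ).ne'
    have ht : (1 - β) ≠ ∞ := ENNReal.sub_ne_top ENNReal.one_ne_top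
    have hC : β * (b' / (1 - β)) + b' = b' / (1 - β) := by
      have h1 : b' = (1 - β) * (b' / (1 - β)) := (ENNReal.mul_div_cancel h0 ht).symm
      calc β * (b' / (1 - β)) + b'
          = β * (b' / (1 - β)) + (1 - β) * (b' / (1 - β)) := by rw [← h1]
        _ = b' / (1 - β) := by rw [← add_mul, add_tsub_cancel_of_le hβ.le, one_mul]
    calc ∫⁻ y, V y ∂(iterKernel P (n + 1) x)
        = ∫⁻ z, ∫⁻ y, V y ∂(P z) ∂(iterKernel P n x) := by
          rw [iterKernel, Kernel.lintegral_comp _ _ _ hV]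
      _ ≤ ∫⁻ z, (β * V z + b') ∂(iterKernel P n x) := lintegral_mono hdrift
      _ = β * ∫⁻ z, V z ∂(iterKernel P n x) + b' := by
          rw [lintegral_add_right _ measurable_const, lintegral_const_mul _ hV]
          simp
      _ ≤ β * (β ^ n * V x + b' / (1 - β)) + b' := by gcongr
      _ = β ^ (n + 1) * V x + (β * (b' / (1 - β)) + b') := by ring
      _ = _ := by rw [hC]

/-- under the geometric drift condition `∫ V dP(x,·) ≤ β V x + b'` with
`0 ≤ β < 1` and `0 ≤ b' < ∞`, if `N` is a probability distribution on the positive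
integers (given by its probability mass function `p`, with `p 0 = 0` and `∑ p n = 1`),
then for every `x`, the chain sampled at an independent time with law `N` satisfies
`∑_{n} p n ∫ V dPⁿ(x,·) ≤ (∑_{n} p n βⁿ) V x + b'/(1 − β)`; in particular the
subsampled drift coefficient `E[β^N] = ∑_{n} p n βⁿ` is `< 1`. -/
theorem geometric_drift_independent_subsampling
    {E : Type*} [MeasurableSpace E] (P : Kernel E E) [IsMarkovKernel P]
    (V : E → ℝ≥0∞) (hV : Measurable V) (β b' : ℝ≥0∞)
    (hβ : β < 1) (hb' : b' ≠ ∞)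
    (hdrift : ∀ x : E, ∫⁻ y, V y ∂(P x) ≤ β * V x + b')
    (p : ℕ → ℝ≥0∞) (hp0 : p 0 = 0) (hp1 : ∑' n, p n = 1) :
    (∀ x : E,
        ∑' n, p n * ∫⁻ y, V y ∂(iterKernel P n x) ≤ (∑' n, p n * β ^ n) * V x + b' / (1 - β))
      ∧ (∑' n, p n * β ^ n) < 1 := by
  refine ⟨fun x => ?_, ?_⟩
  · calc ∑' n, p n * ∫⁻ y, V y ∂(iterKernel P n x)
        ≤ ∑' n, (p n * β ^ n * V x + p n * (b' / (1 - β))) := by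
          refine ENNReal.tsum_le_tsum fun n => ?_
          rw [mul_assoc, ← mul_add]
          gcongr
          exact iterKernel_drift P V hV β b' hβ hdrift n x
      _ = _ := by
          rw [ENNReal.tsum_add, ENNReal.tsum_mul_right, ENNReal.tsum_mul_right, hp1, one_mul]
  · refine lt_of_le_of_lt ?_ hβ
    calc ∑' n, p n * β ^ n ≤ ∑' n, p n * β := by
          refine ENNReal.tsum_le_tsum fun n => ?_
          rcases Nat.eq_zero_or_pos n with rfl | hn
          · simp [hp0]
          · gcongr
            exact pow_le_of_le_one zero_le hβ.le hn.ne'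
      _ = β := by rw [ENNReal.tsum_mul_right, hp1, one_mul]
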